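/- Let Ω ⊆ ℝ^{n+1} be a nonempty proper open convex cone and let F be a canonical potential of Ω. Then for every x ∈ Ω, F(x) = sup{ G(x) : G : Ω → ℝ is C², convex, and det D²G ≥ e^{2G} on Ω }, and moreover this supremum is attained by G = F. -/

import Mathlib

open scoped RealInnerProductSpace

noncomputable section

abbrev Euc (m : ℕ) : Type := EuclideanSpace ℝ (Fin m)

/-- The Hessian matrix of `F` at `x` in the standard coordinates. -/
def hessMatrix {m : ℕ} (F : Euc m → ℝ) (x : Euc m) : Matrix (Fin m) (Fin m) ℝ :=
  fun i j => iteratedFDeriv ℝ 2 F x ![EuclideanSpace.single i 1, EuclideanSpace.single j 1]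

/-- A nonempty proper open convex cone in `ℝ^m`. -/
def IsOpenProperConvexCone {m : ℕ} (Ω : Set (Euc m)) : Prop :=
  Ω.Nonempty ∧ IsOpen Ω ∧ Convex ℝ Ω ∧
    (∀ x ∈ Ω, ∀ t : ℝ, Real.exp t • x ∈ Ω) ∧
    ¬ ∃ p v : Euc m, v ≠ 0 ∧ ∀ t : ℝ, p + t • v ∈ closure Ω

/-- `F` tends to `+∞` along every sequence in `Ω` converging to a boundary point of `Ω`. -/
def BlowsUpOnBoundary {m : ℕ} (Ω : Set (Euc m)) (F : Euc m → ℝ) : Prop :=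
  ∀ z ∈ frontier Ω, ∀ x : ℕ → Euc m, (∀ k, x k ∈ Ω) →
    Filter.Tendsto x Filter.atTop (nhds z) →
    Filter.Tendsto (fun k => F (x k)) Filter.atTop Filter.atTop

/-- The canonical potential of a proper open convex cone `Ω ⊆ ℝ^{n+1}`. -/
def IsCanonicalPotential (n : ℕ) (Ω : Set (Euc (n+1))) (F : Euc (n+1) → ℝ) : Prop :=
  ContDiffOn ℝ (⊤ : ℕ∞) F Ω ∧
  (∀ x ∈ Ω, (hessMatrix F x).PosDef) ∧
  (∀ x ∈ Ω, (hessMatrix F x).det = Real.exp (2 * F x)) ∧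
  (∀ x ∈ Ω, ∀ t : ℝ, F (Real.exp t • x) = F x - (n + 1) * t) ∧
  BlowsUpOnBoundary Ω F

/-- The open dual cone of `Ω`. -/
def openDualCone {m : ℕ} (Ω : Set (Euc m)) : Set (Euc m) :=
  {y | ∀ x ∈ closure Ω, x ≠ 0 → 0 < ⟪x, y⟫}

open Matrix
open Polynomial in
theorem det_one_add_psd {m : ℕ} (P : Matrix (Fin m) (Fin m) ℝ) (hP : P.PosSemidef) :
    1 ≤ (1 + P).det := by
  have h1 : (1 + P).det = ∏ i, (1 + hP.1.eigenvalues i) := by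
    have h := congrArg (fun p => p.eval (-1)) hP.1.charpoly_eq
    simp only [Matrix.eval_charpoly, Polynomial.eval_prod] at h
    have e : (scalar (Fin m) (-1:ℝ)) - P = -(1 + P) := by
      ext i j; simp [Matrix.scalar_apply, Matrix.diagonal, Matrix.one_apply]; split_ifs <;> ring
    rw [e, Matrix.det_neg] at h
    have : ∀ i, eval (-1) (X - C (hP.1.eigenvalues i)) = (-1) * (1 + hP.1.eigenvalues i) := by
      intro i; simp; ring
    simp only [RCLike.ofReal_real_eq_id, id, this, Finset.prod_mul_distrib] at h
    simp only [Finset.prod_const, Finset.card_univ] at h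
    exact mul_left_cancel₀ (by positivity) h
  rw [h1]
  calc (1:ℝ) = ∏ i : Fin m, (1:ℝ) := by simp
    _ ≤ _ := Finset.prod_le_prod (by simp) (fun i _ => by linarith [hP.eigenvalues_nonneg i])

theorem det_mono_psd {m : ℕ} (A B : Matrix (Fin m) (Fin m) ℝ) (hA : A.PosSemidef)
    (hd : 0 < A.det) (hB : (B - A).PosSemidef) : A.det ≤ B.det := by
  obtain ⟨C, hC⟩ : ∃ C : Matrix (Fin m) (Fin m) ℝ, A = Cᴴ * C := by
    open scoped MatrixOrder in
    exact CStarAlgebra.nonneg_iff_eq_star_mul_self.mp hA.nonneg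
  have hdet : A.det = C.det * C.det := by rw [hC]; simp
  have hu : IsUnit C.det := by
    rw [isUnit_iff_ne_zero]; rintro h; rw [hdet, h] at hd; simp at hd
  have hP := hB.conjTranspose_mul_mul_same C⁻¹
  have e : B = Cᴴ * (1 + (C⁻¹)ᴴ * (B - A) * C⁻¹) * C := by
    have h1 : C⁻¹ * C = 1 := Matrix.nonsing_inv_mul C hu
    have h2 : Cᴴ * (C⁻¹)ᴴ = 1 := by rw [← Matrix.conjTranspose_mul, h1]; simp
    have : Cᴴ * ((C⁻¹)ᴴ * (B - A) * C⁻¹) * C = (Cᴴ * (C⁻¹)ᴴ) * (B - A) * (C⁻¹ * C) := by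
      simp only [Matrix.mul_assoc]
    rw [Matrix.mul_add, Matrix.add_mul, this, h1, h2, Matrix.mul_one, ← hC]; simp
  have := det_one_add_psd _ hP
  rw [e, Matrix.det_mul, Matrix.det_mul, hdet]
  simp only [Matrix.det_conjTranspose, star_trivial]
  nlinarith [mul_self_nonneg C.det]

theorem snd_deriv_nonneg (f f' : ℝ → ℝ) (c : ℝ) (hm : IsLocalMin f 0)
    (h1 : ∀ᶠ t in nhds 0, HasDerivAt f (f' t) t) (h2 : HasDerivAt f' c 0) : 0 ≤ c := by
  by_contra hc
  push Not at hc
  have e : deriv f =ᶠ[nhds 0] f' := h1.mono fun t ht => ht.deriv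
  have e2 : deriv (deriv f) 0 = c := by rw [e.deriv_eq]; exact h2.deriv
  have hmax : IsLocalMax f 0 := by
    apply isLocalMax_of_deriv_deriv_neg (by rw [e2]; exact hc) hm.deriv_eq_zero
    exact h1.self_of_nhds.continuousAt
  have hconst : f =ᶠ[nhds 0] fun _ => f 0 := by
    filter_upwards [hm, hmax] with t a b using le_antisymm b a
  have := hconst.deriv.deriv_eq
  simp at this
  linarith [e2]

theorem line_deriv_one {m : ℕ} (G : Euc m → ℝ) (x v : Euc m) (h : ContDiffAt ℝ 2 G x) :
    ∀ᶠ t in nhds (0:ℝ), HasDerivAt (fun t : ℝ => G (x + t • v)) (fderiv ℝ G (x + t • v) v) t := by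
  have h1 : ∀ᶠ y in nhds x, DifferentiableAt ℝ G y :=
    (h.eventually (by simp)).mono fun y hy => hy.differentiableAt (by simp)
  have hc : Filter.Tendsto (fun t : ℝ => x + t • v) (nhds 0) (nhds x) := by
    have : Continuous (fun t : ℝ => x + t • v) := by fun_prop
    simpa using this.tendsto 0
  filter_upwards [hc.eventually h1] with t ht
  have hl : HasDerivAt (fun t : ℝ => x + t • v) v t := by
    simpa using ((hasDerivAt_id t).smul_const v).const_add x
  exact ht.hasFDerivAt.comp_hasDerivAt t hl

theorem line_deriv_two {m : ℕ} (G : Euc m → ℝ) (x v : Euc m) (h : ContDiffAt ℝ 2 G x) :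
    HasDerivAt (fun t : ℝ => fderiv ℝ G (x + t • v) v) (fderiv ℝ (fderiv ℝ G) x v v) 0 := by
  have hd : DifferentiableAt ℝ (fderiv ℝ G) x :=
    (h.fderiv_right (m := 1) (by norm_num)).differentiableAt (by simp)
  have hl : HasDerivAt (fun t : ℝ => x + t • v) v 0 := by
    simpa using ((hasDerivAt_id (0:ℝ)).smul_const v).const_add x
  have hd' : HasFDerivAt (fderiv ℝ G) (fderiv ℝ (fderiv ℝ G) x) (x + (0:ℝ) • v) := by
    simpa using hd.hasFDerivAt
  have := hd'.comp_hasDerivAt (0:ℝ) hl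
  simpa using this.clm_apply (hasDerivAt_const (0:ℝ) v)

theorem hess_quad {m : ℕ} (G : Euc m → ℝ) (x v : Euc m) :
    (v.ofLp) ⬝ᵥ ((hessMatrix G x) *ᵥ v.ofLp) = fderiv ℝ (fderiv ℝ G) x v v := by
  have hv : v = ∑ i, v i • EuclideanSpace.single i (1:ℝ) := by
    ext j
    simp [Finset.sum_apply, Pi.single_apply]
  conv_rhs => rw [hv]
  simp only [map_sum, map_smul, _root_.sum_apply, _root_.smul_apply,
    dotProduct, mulVec, hessMatrix, iteratedFDeriv_two_apply, smul_eq_mul, Finset.mul_sum]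
  rw [Finset.sum_comm]
  refine Finset.sum_congr rfl fun i _ => Finset.sum_congr rfl fun j _ => ?_
  simp
  ring

theorem hess_herm {m : ℕ} (G : Euc m → ℝ) (x : Euc m) (h : ContDiffAt ℝ 2 G x) :
    (hessMatrix G x).IsHermitian := by
  ext i j
  have := (h.isSymmSndFDerivAt (by simp)).eq
    (EuclideanSpace.single i 1) (EuclideanSpace.single j 1)
  simp [hessMatrix, iteratedFDeriv_two_apply, this]

/-- at an interior minimum, Hessians are ordered -/
theorem hess_le_of_min {m : ℕ} (w' : Euc m → ℝ → ℝ) (q : Euc m → ℝ) (W G : Euc m → ℝ) (z : Euc m)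
    (hG : ContDiffAt ℝ 2 G z) (hmin : IsLocalMin (fun y => W y - G y) z)
    (h1 : ∀ v, ∀ᶠ t in nhds (0:ℝ), HasDerivAt (fun t : ℝ => W (z + t • v)) (w' v t) t)
    (h2 : ∀ v, HasDerivAt (w' v) (q v) 0) (v : Euc m) :
    fderiv ℝ (fderiv ℝ G) z v v ≤ q v := by
  have hc : Filter.Tendsto (fun t : ℝ => z + t • v) (nhds 0) (nhds z) := by
    have : Continuous (fun t : ℝ => z + t • v) := by fun_prop
    simpa using this.tendsto 0
  have := snd_deriv_nonneg (fun t => W (z + t • v) - G (z + t • v))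
    (fun t => w' v t - fderiv ℝ G (z + t • v) v) (q v - fderiv ℝ (fderiv ℝ G) z v v)
    (by have := hc.eventually hmin
        simpa [IsLocalMin, IsMinFilter] using this)
    (by filter_upwards [h1 v, line_deriv_one G z v hG] with t a b using a.sub b)
    ((h2 v).sub (line_deriv_two G z v hG))
  linarith

theorem hess_psd_of_convex {m : ℕ} (G : Euc m → ℝ) (U : Set (Euc m)) (hU : IsOpen U) (z : Euc m)
    (hz : z ∈ U) (hG : ContDiffAt ℝ 2 G z) (hc : ConvexOn ℝ U G) :
    (hessMatrix G z).PosSemidef := by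
  refine Matrix.PosSemidef.of_dotProduct_mulVec_nonneg (hess_herm G z hG) fun v => ?_
  have e := hess_quad G z (WithLp.toLp 2 v)
  simp only [star_trivial] at e ⊢
  rw [e]
  set V : Euc m := WithLp.toLp 2 v
  have hd := line_deriv_one G z V hG
  have hg : ContinuousAt (fun t : ℝ => z + t • V) 0 := by fun_prop
  have hmem : ∀ᶠ t in nhds (0:ℝ), z + t • V ∈ U :=
    hg.eventually (hU.mem_nhds (by simpa using hz))
  obtain ⟨ε, he, hball⟩ := Metric.eventually_nhds_iff_ball.1 (hd.and hmem)
  have hconv : ConvexOn ℝ (Metric.ball (0:ℝ) ε) (fun t : ℝ => G (z + t • V)) := by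
    refine ⟨convex_ball _ _, fun a ha b hb s t hs ht hst => ?_⟩
    have := hc.2 (hball a ha).2 (hball b hb).2 hs ht hst
    convert this using 2
    have hz : z = s • z + t • z := by rw [← add_smul, hst, one_smul]
    conv_lhs => rw [hz]
    simp only [smul_add, add_smul, smul_smul, smul_eq_mul]
    abel
  have hmono := hconv.monotoneOn_deriv (fun t ht => (hball t ht).1.differentiableAt)
  have hmono' : MonotoneOn (fun t : ℝ => fderiv ℝ G (z + t • V) V) (Metric.ball (0:ℝ) ε) := by
    intro a ha b hb hab
    have := hmono ha hb hab
    rwa [(hball a ha).1.deriv, (hball b hb).1.deriv] at this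
  have h3 := hmono'.derivWithin_nonneg (x := 0)
  rw [derivWithin_of_isOpen Metric.isOpen_ball (Metric.mem_ball_self he),
    (line_deriv_two G z V hG).deriv] at h3
  exact h3

theorem line_aux {m : ℕ} (x v : Euc m) (s t : ℝ) : x + t • v + (s - t) • v = x + s • v := by
  rw [sub_smul]; abel

theorem convexOn_of_hess {m : ℕ} (F : Euc m → ℝ) (U : Set (Euc m)) (hU : IsOpen U)
    (hc : Convex ℝ U) (hF : ContDiffOn ℝ 2 F U) (hp : ∀ x ∈ U, (hessMatrix F x).PosDef) :
    ConvexOn ℝ U F := by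
  refine ⟨hc, fun x hx y hy a b ha hb hab => ?_⟩
  have hmem : ∀ t ∈ Set.Icc (0:ℝ) 1, x + t • (y - x) ∈ U := fun t ht => by
    have := hc hx hy (sub_nonneg.2 ht.2) ht.1 (by ring)
    convert this using 1
    rw [smul_sub, sub_smul, one_smul]; abel
  have hat : ∀ t ∈ Set.Icc (0:ℝ) 1, ContDiffAt ℝ 2 F (x + t • (y - x)) := fun t ht =>
    hF.contDiffAt (hU.mem_nhds (hmem t ht))
  have key : ConvexOn ℝ (Set.Icc (0:ℝ) 1) (fun t : ℝ => F (x + t • (y - x))) := by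
    have d1 : ∀ t ∈ Set.Icc (0:ℝ) 1, HasDerivAt (fun t : ℝ => F (x + t • (y - x)))
        (fderiv ℝ F (x + t • (y - x)) (y - x)) t := fun t ht => by
      have := (line_deriv_one F _ (y - x) (hat t ht)).self_of_nhds
      simp only [zero_smul, add_zero] at this
      have h2 := HasDerivAt.comp_sub_const t t (by rw [sub_self]; exact this)
      simpa only [line_aux] using h2
    have d2 : ∀ t ∈ Set.Icc (0:ℝ) 1, HasDerivAt (fun t : ℝ => fderiv ℝ F (x + t • (y - x)) (y - x))
        (fderiv ℝ (fderiv ℝ F) (x + t • (y - x)) (y - x) (y - x)) t := fun t ht => by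
      have := (line_deriv_two F _ (y - x) (hat t ht))
      have h2 := HasDerivAt.comp_sub_const t t (by rw [sub_self]; exact this)
      simpa only [line_aux] using h2
    refine convexOn_of_hasDerivWithinAt2_nonneg (convex_Icc 0 1)
      (fun t ht => (d1 t ht).continuousAt.continuousWithinAt)
      (fun t ht => (d1 t (interior_subset ht)).hasDerivWithinAt)
      (fun t ht => (d2 t (interior_subset ht)).hasDerivWithinAt) (fun t ht => ?_)
    rw [← hess_quad]
    simpa using (hp _ (hmem t (interior_subset ht))).posSemidef.dotProduct_mulVec_nonneg
      (y - x).ofLp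
  have := key.2 (Set.left_mem_Icc.2 zero_le_one) (Set.right_mem_Icc.2 zero_le_one) ha hb hab
  simp only [smul_eq_mul, mul_zero, mul_one, zero_add, zero_smul, add_zero, one_smul,
    add_sub_cancel] at this
  have e : a • x + b • y = x + b • (y - x) := by
    obtain rfl : a = 1 - b := by linarith
    rw [smul_sub, sub_smul, one_smul]; abel
  rw [e]
  exact this

theorem closed_sublevel {m : ℕ} (U : Set (Euc m)) (hU : IsOpen U) (f : Euc m → ℝ)
    (hf : ContinuousOn f U) (hb : BlowsUpOnBoundary U f) (c : ℝ) :
    IsClosed {y | y ∈ U ∧ f y ≤ c} := by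
  apply IsSeqClosed.isClosed
  intro x z hx hz
  have hzc : z ∈ closure U := mem_closure_of_tendsto hz (Filter.Eventually.of_forall fun k => (hx k).1)
  by_cases hzU : z ∈ U
  · refine ⟨hzU, ?_⟩
    have h1 := (hf.continuousAt (hU.mem_nhds hzU)).tendsto.comp hz
    exact le_of_tendsto h1 (Filter.Eventually.of_forall fun k => (hx k).2)
  · have hfr : z ∈ frontier U := by rw [hU.frontier_eq]; exact ⟨hzc, hzU⟩
    have h1 := hb z hfr x (fun k => (hx k).1) hz
    obtain ⟨k, hk⟩ := (h1.eventually_gt_atTop c).exists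
    exact absurd (hx k).2 (not_le.2 hk)

theorem min_exists {m : ℕ} (U : Set (Euc m)) (hU : IsOpen U) (hne : U.Nonempty) (f : Euc m → ℝ)
    (hf : ContinuousOn f U) (hb : BlowsUpOnBoundary U f)
    (hbd : ∀ c, Bornology.IsBounded {y | y ∈ U ∧ f y ≤ c}) :
    ∃ z ∈ U, ∀ y ∈ U, f z ≤ f y := by
  obtain ⟨p, hp⟩ := hne
  have hc : IsCompact {y | y ∈ U ∧ f y ≤ f p} :=
    Metric.isCompact_of_isClosed_isBounded (closed_sublevel U hU f hf hb _) (hbd _)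
  obtain ⟨z, hz, hmin⟩ := hc.exists_isMinOn ⟨p, hp, le_rfl⟩ (hf.mono fun y hy => hy.1)
  refine ⟨z, hz.1, fun y hy => ?_⟩
  by_cases h : f y ≤ f p
  · exact hmin ⟨hy, h⟩
  · exact hz.2.trans (le_of_not_ge h)

theorem cone_smul {m : ℕ} {Ω : Set (Euc m)} (hΩ : IsOpenProperConvexCone Ω) {x : Euc m}
    (hx : x ∈ Ω) {c : ℝ} (hc : 0 < c) : c • x ∈ Ω := by
  have := hΩ.2.2.2.1 x hx (Real.log c)
  rwa [Real.exp_log hc] at this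

theorem cone_add {m : ℕ} {Ω : Set (Euc m)} (hΩ : IsOpenProperConvexCone Ω) {x y : Euc m}
    (hx : x ∈ Ω) (hy : y ∈ Ω) : x + y ∈ Ω := by
  have h := hΩ.2.2.1 hx hy (show (0:ℝ) ≤ 1/2 by norm_num) (show (0:ℝ) ≤ 1/2 by norm_num)
    (by norm_num)
  have := cone_smul hΩ h (c := 2) (by norm_num)
  simpa [smul_add, smul_smul] using this

theorem cone_closure_smul {m : ℕ} {Ω : Set (Euc m)} (hΩ : IsOpenProperConvexCone Ω) {x : Euc m}
    (hx : x ∈ closure Ω) {c : ℝ} (hc : 0 ≤ c) : c • x ∈ closure Ω := by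
  have key : ∀ c : ℝ, 0 < c → c • x ∈ closure Ω := fun c hc => by
    have : Set.MapsTo (fun y : Euc m => c • y) Ω Ω := fun y hy => cone_smul hΩ hy hc
    exact this.closure (by fun_prop) hx
  rcases hc.eq_or_lt with rfl | hc
  · have ht : Filter.Tendsto (fun c : ℝ => c • x) (nhdsWithin 0 (Set.Ioi 0)) (nhds ((0:ℝ) • x)) := by
      have : Continuous (fun c : ℝ => c • x) := by fun_prop
      exact (this.tendsto 0).mono_left nhdsWithin_le_nhds
    exact isClosed_closure.mem_of_tendsto ht
      (by filter_upwards [self_mem_nhdsWithin] with c hc using key c hc)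
  · exact key c hc

theorem exists_pos_functional {m : ℕ} {Ω : Set (Euc m)} (hΩ : IsOpenProperConvexCone Ω) :
    ∃ (l : Euc m →L[ℝ] ℝ) (s : ℝ), 0 < s ∧ ∀ x ∈ Ω, s * ‖x‖ ≤ l x := by
  set K := closure Ω ∩ Metric.sphere (0 : Euc m) 1 with hK
  have hKc : IsCompact K := (isCompact_sphere _ _).inter_left isClosed_closure
  have hconv : Convex ℝ (closure Ω) := hΩ.2.2.1.closure
  obtain ⟨x0, hx0⟩ := hΩ.1
  have h0 : (0 : Euc m) ∈ closure Ω := by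
    simpa using cone_closure_smul hΩ (subset_closure hx0) le_rfl
  have hf : ∀ z : Euc m, ∃ f : Euc m →L[ℝ] ℝ, z ∈ K →
      (∀ y ∈ closure Ω, 0 ≤ f y) ∧ 0 < f z := by
    intro z
    by_cases hz : z ∈ K
    swap
    · exact ⟨0, fun h => absurd h hz⟩
    have hz0 : z ≠ 0 := by
      rintro rfl
      simpa using hz.2
    have hneg : -z ∉ closure Ω := by
      intro hn
      refine hΩ.2.2.2.2 ⟨0, z, hz0, fun t => ?_⟩
      rcases le_total 0 t with ht | ht
      · simpa using cone_closure_smul hΩ hz.1 ht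
      · simpa using cone_closure_smul hΩ hn (neg_nonneg.2 ht)
    obtain ⟨f, u, hu, hfu⟩ := geometric_hahn_banach_point_closed hconv isClosed_closure hneg
    have hu0 : u < 0 := by simpa using hfu 0 h0
    refine ⟨f, fun _ => ⟨fun y hy => ?_, ?_⟩⟩
    · by_contra hneg'
      push Not at hneg'
      have h1 := hfu _ (cone_closure_smul hΩ hy (c := u / f y) (div_nonneg_of_nonpos hu0.le hneg'.le))
      rw [map_smul, smul_eq_mul, div_mul_cancel₀ _ hneg'.ne] at h1
      exact lt_irrefl _ h1
    · rw [map_neg] at hu; linarith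
  choose f hf using hf
  obtain ⟨t, htK, ht⟩ := hKc.elim_nhds_subcover (fun z => {y | 0 < f z y}) (fun z hz =>
    (isOpen_lt continuous_const (f z).continuous).mem_nhds (hf z hz).2)
  set l := ∑ z ∈ t, f z with hl
  have hlpos : ∀ y ∈ K, 0 < l y := by
    intro y hy
    obtain ⟨z, hzt, hzy⟩ := Set.mem_iUnion₂.1 (ht hy)
    rw [hl, _root_.sum_apply]
    exact Finset.sum_pos' (fun w hw => (hf w (htK w hw)).1 y hy.1) ⟨z, hzt, hzy⟩
  have hs : ∃ s : ℝ, 0 < s ∧ ∀ y ∈ K, s ≤ l y := by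
    rcases K.eq_empty_or_nonempty with he | hne
    · exact ⟨1, one_pos, by simp [he]⟩
    · obtain ⟨y, hy, hmin⟩ := hKc.exists_isMinOn hne l.continuous.continuousOn
      exact ⟨l y, hlpos y hy, fun w hw => hmin hw⟩
  obtain ⟨s, hs0, hs⟩ := hs
  refine ⟨l, s, hs0, fun x hx => ?_⟩
  by_cases hx0 : x = 0
  · simp [hx0]
  have hn : 0 < ‖x‖ := norm_pos_iff.2 hx0
  have := hs (‖x‖⁻¹ • x) ⟨cone_closure_smul hΩ (subset_closure hx) (by positivity), by
    simp [norm_smul, hn.ne']⟩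
  rw [map_smul, smul_eq_mul, ← div_eq_inv_mul, le_div_iff₀ hn] at this
  exact this

/-- logarithmic lower bound for the canonical potential -/
theorem F_lower {n : ℕ} {Ω : Set (Euc (n+1))} (hΩ : IsOpenProperConvexCone Ω)
    {F : Euc (n+1) → ℝ} (hF : IsCanonicalPotential n Ω F) :
    ∃ C : ℝ, ∀ x ∈ Ω, 0 < ‖x‖ ∧ - C - (n+1) * Real.log ‖x‖ ≤ F x := by
  obtain ⟨hF1, hF2, hF3, hF4, hF5⟩ := hF
  have hcont : ContinuousOn F Ω := hF1.continuousOn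
  have hK : IsCompact ({y | y ∈ Ω ∧ F y ≤ 0} ∩ Metric.sphere 0 1) :=
    (isCompact_sphere _ _).inter_left (closed_sublevel Ω hΩ.2.1 F hcont hF5 0)
  obtain ⟨B, hB⟩ := hK.bddBelow_image (hcont.mono fun y hy => hy.1.1)
  refine ⟨-min B 0, fun x hx => ?_⟩
  have hx0 : x ≠ 0 := by
    rintro rfl
    have := hF4 0 hx 1
    simp at this
    have hn : (0:ℝ) ≤ n := Nat.cast_nonneg n
    linarith
  have hn : 0 < ‖x‖ := norm_pos_iff.2 hx0
  refine ⟨hn, ?_⟩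
  have hy : ‖x‖⁻¹ • x ∈ Ω := cone_smul hΩ hx (by positivity)
  have h1 := hF4 _ hy (Real.log ‖x‖)
  rw [Real.exp_log hn, smul_smul, mul_inv_cancel₀ hn.ne', one_smul] at h1
  have h2 : min B 0 ≤ F (‖x‖⁻¹ • x) := by
    by_cases h : F (‖x‖⁻¹ • x) ≤ 0
    · exact (min_le_left _ _).trans (hB ⟨_, ⟨⟨hy, h⟩, by simp [norm_smul, hn.ne']⟩, rfl⟩)
    · exact (min_le_right _ _).trans (le_of_not_ge h)
  linarith

theorem two_le_top : (2 : WithTop ℕ∞) ≤ ((⊤ : ℕ∞) : WithTop ℕ∞) := by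
  have : ((2 : ℕ∞) : WithTop ℕ∞) ≤ ((⊤ : ℕ∞) : WithTop ℕ∞) := WithTop.coe_le_coe.2 le_top
  exact this

/-- `C²` convex subsolutions on `U`. -/
def IsSub {m : ℕ} (U : Set (Euc m)) (G : Euc m → ℝ) : Prop :=
  ContDiffOn ℝ 2 G U ∧ ConvexOn ℝ U G ∧ ∀ z ∈ U, Real.exp (2 * G z) ≤ (hessMatrix G z).det

theorem IsSub.translate {m : ℕ} {U : Set (Euc m)} {G : Euc m → ℝ} (h : IsSub U G) (c : Euc m) :
    IsSub ((fun z => z + c) ⁻¹' U) (fun z => G (z + c)) := by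
  refine ⟨h.1.comp (by fun_prop) (fun z hz => hz), ?_, fun z hz => ?_⟩
  · have := h.2.1.translate_left c
    simpa only [add_comm c] using! this
  have e : hessMatrix (fun z => G (z + c)) z = hessMatrix G (z + c) := by
    ext i j
    simp only [hessMatrix, iteratedFDeriv_comp_add_right]
  rw [e]
  exact h.2.2 _ hz

theorem IsSub.mono {m : ℕ} {U V : Set (Euc m)} {G : Euc m → ℝ} (h : IsSub U G) (hVU : V ⊆ U)
    (hV : Convex ℝ V) : IsSub V G :=
  ⟨h.1.mono hVU, h.2.1.subset hVU hV, fun z hz => h.2.2 z (hVU hz)⟩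

/-- comparison at a minimum point -/
theorem IsSub.le_at_min {m : ℕ} {U : Set (Euc m)} {G : Euc m → ℝ} (h : IsSub U G) (hU : IsOpen U)
    (W : Euc m → ℝ) (B : Matrix (Fin m) (Fin m) ℝ) (hB : B.IsHermitian) (w' : Euc m → ℝ → ℝ)
    (z : Euc m) (hz : z ∈ U) (hmin : IsLocalMin (fun y => W y - G y) z)
    (h1 : ∀ v, ∀ᶠ t in nhds (0:ℝ), HasDerivAt (fun t : ℝ => W (z + t • v)) (w' v t) t)
    (h2 : ∀ v : Euc m, HasDerivAt (w' v) (v.ofLp ⬝ᵥ (B *ᵥ v.ofLp)) 0)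
    (hdet : B.det ≤ Real.exp (2 * W z)) : G z ≤ W z := by
  have hG : ContDiffAt ℝ 2 G z := h.1.contDiffAt (hU.mem_nhds hz)
  have hle := hess_le_of_min w' (fun v => v.ofLp ⬝ᵥ (B *ᵥ v.ofLp)) W G z hG hmin h1 h2
  have hpsd := hess_psd_of_convex G U hU z hz hG h.2.1
  have hdG := h.2.2 z hz
  have hpos : 0 < (hessMatrix G z).det := (Real.exp_pos _).trans_le hdG
  have := det_mono_psd _ B hpsd hpos
    (Matrix.PosSemidef.of_dotProduct_mulVec_nonneg (hB.sub hpsd.1) fun v => by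
      have e := hle (WithLp.toLp 2 v)
      rw [← hess_quad] at e
      simp only [star_trivial, Matrix.sub_mulVec, dotProduct_sub]
      linarith)
  have := Real.exp_le_exp.1 (hdG.trans (this.trans hdet))
  linarith

theorem euc_norm_le {m : ℕ} (x : Euc m) (r : ℝ) (h : ∀ i, |x i| ≤ r) : ‖x‖ ≤ m * r := by
  have hv : x = ∑ i, x i • EuclideanSpace.single i (1:ℝ) := by
    ext j
    simp [Finset.sum_apply, Pi.single_apply]
  rw [hv]
  refine (norm_sum_le _ _).trans ?_
  refine (Finset.sum_le_sum (g := fun _ => r) fun i _ => ?_).trans (by simp)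
  simpa [norm_smul] using h i

/-- one dimensional barrier -/
def bar (r t : ℝ) : ℝ := Real.log (r^2) - Real.log (r^2 - t^2)

theorem bar_deriv (r t : ℝ) (ht : |t| < r) :
    HasDerivAt (bar r) (2 * t / (r^2 - t^2)) t := by
  have h0 : 0 < r^2 - t^2 := by nlinarith [abs_nonneg t, sq_abs t]
  have h1 : HasDerivAt (fun t : ℝ => r^2 - t^2) (-(2*t)) t := by
    simpa using (hasDerivAt_pow 2 t).const_sub (r^2)
  have := (h1.log h0.ne').const_sub (Real.log (r^2))
  exact this.congr_deriv (by ring)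

theorem bar_deriv2 (r t : ℝ) (ht : |t| < r) :
    HasDerivAt (fun t => 2 * t / (r^2 - t^2)) (2 * (r^2 + t^2) / (r^2 - t^2)^2) t := by
  have h0 : 0 < r^2 - t^2 := by nlinarith [abs_nonneg t, sq_abs t]
  have h1 : HasDerivAt (fun t : ℝ => r^2 - t^2) (-(2*t)) t := by
    simpa using (hasDerivAt_pow 2 t).const_sub (r^2)
  have h2 : HasDerivAt (fun t : ℝ => 2 * t) 2 t := by
    simpa using (hasDerivAt_id t).const_mul (2:ℝ)
  exact (h2.div h1 h0.ne').congr_deriv (by ring)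

theorem bar_nonneg (r t : ℝ) (ht : |t| < r) : 0 ≤ bar r t := by
  have h0 : 0 < r^2 - t^2 := by nlinarith [abs_nonneg t, sq_abs t]
  have := Real.log_le_log h0 (show r^2 - t^2 ≤ r^2 by nlinarith)
  unfold bar
  linarith

theorem bar_exp (r t : ℝ) (ht : |t| < r) :
    2 * (r^2 + t^2) / (r^2 - t^2)^2 ≤ Real.exp (2 * (bar r t + Real.log (4 / r^2) / 2)) := by
  have h0 : 0 < r^2 - t^2 := by nlinarith [abs_nonneg t, sq_abs t]
  have hr : 0 < r := (abs_nonneg t).trans_lt ht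
  have hr2 : 0 < r^2 := by positivity
  have e : 2 * (bar r t + Real.log (4 / r^2) / 2) =
      Real.log (r^2) + Real.log (r^2) + Real.log (4 / r^2)
        - (Real.log (r^2 - t^2) + Real.log (r^2 - t^2)) := by unfold bar; ring
  rw [e, Real.exp_sub, Real.exp_add, Real.exp_add, Real.exp_add, Real.exp_log hr2,
    Real.exp_log h0, Real.exp_log (by positivity)]
  have e2 : r^2 * r^2 * (4 / r^2) = 4 * r^2 := by field_simp
  rw [e2, ← sq]
  exact div_le_div_of_nonneg_right (by nlinarith) (by positivity)

theorem cube_bound {m : ℕ} {V : Set (Euc m)} (hV : IsOpen V) {H : Euc m → ℝ} (hH : IsSub V H)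
    (r : ℝ) (hr : 0 < r) (hcube : ∀ x : Euc m, (∀ i, |x i| ≤ r) → x ∈ V) :
    H 0 ≤ m * (Real.log (4 / r^2) / 2) := by
  set κ := Real.log (4 / r^2) / 2 with hκ
  set Q : Set (Euc m) := {x | ∀ i, |x i| < r} with hQ
  set C : Set (Euc m) := {x | ∀ i, |x i| ≤ r} with hC
  set w : Euc m → ℝ := fun x => ∑ i, (bar r (x i) + κ) with hw
  have hQo : IsOpen Q := by
    rw [hQ, Set.ofPred_forall]
    exact isOpen_iInter_of_finite fun i => isOpen_lt (by fun_prop) continuous_const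
  have hCc : IsClosed C := by
    rw [hC, Set.ofPred_forall]
    exact isClosed_iInter fun i => isClosed_le (by fun_prop) continuous_const
  have hQC : Q ⊆ C := fun x hx i => (hx i).le
  have hCb : Bornology.IsBounded C := by
    rw [Metric.isBounded_iff_subset_closedBall (0 : Euc m)]
    exact ⟨m * r, fun x hx => by simpa using euc_norm_le x r hx⟩
  have hCK : IsCompact C := Metric.isCompact_of_isClosed_isBounded hCc hCb
  have hCV : C ⊆ V := fun x hx => hcube x hx
  have h0Q : (0 : Euc m) ∈ Q := fun i => by simpa using hr
  obtain ⟨M, hM⟩ := hCK.bddAbove_image (hH.1.continuousOn.mono hCV)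
  have hM' : ∀ x ∈ C, H x ≤ M := fun x hx => hM ⟨x, hx, rfl⟩
  have hwc : ContinuousOn w Q := by
    refine continuousOn_finsetSum _ fun i _ => ?_
    refine ContinuousOn.add ?_ continuousOn_const
    intro x hx
    have h1 := (bar_deriv r (x i) (hx i)).continuousAt
    have h2 : ContinuousAt (fun x : Euc m => x i) x := by fun_prop
    exact (ContinuousAt.comp (f := fun x : Euc m => x i) h1 h2).continuousWithinAt
  have hfc : ContinuousOn (fun x => w x - H x) Q :=
    hwc.sub (hH.1.continuousOn.mono (hQC.trans hCV))
  have hblow : BlowsUpOnBoundary Q (fun x => w x - H x) := by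
    intro z hz x hx hxz
    rw [hQo.frontier_eq] at hz
    have hzC : z ∈ C := closure_minimal hQC hCc hz.1
    obtain ⟨i, hi⟩ : ∃ i, r ≤ |z i| := by
      by_contra hcon
      push Not at hcon
      exact hz.2 hcon
    have hzi : |z i| = r := le_antisymm (hzC i) hi
    have hxi : Filter.Tendsto (fun k => r^2 - (x k i)^2) Filter.atTop
        (nhdsWithin 0 (Set.Ioi 0)) := by
      rw [tendsto_nhdsWithin_iff]
      constructor
      · have hcont : Continuous (fun y : Euc m => r^2 - (y i)^2) := by fun_prop
        have := (hcont.tendsto z).comp hxz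
        have e : r^2 - (z i)^2 = 0 := by rw [← sq_abs (z i), hzi]; ring
        rw [e] at this
        exact this
      · refine Filter.Eventually.of_forall fun k => ?_
        have := hx k i
        simp only [Set.mem_Ioi]
        nlinarith [abs_nonneg (x k i), sq_abs (x k i)]
    have hlog := Real.tendsto_log_nhdsGT_zero.comp hxi
    have hbar : Filter.Tendsto (fun k => bar r (x k i)) Filter.atTop Filter.atTop := by
      have := Filter.tendsto_atTop_add_const_left _ (Real.log (r^2))
        (Filter.tendsto_neg_atBot_atTop.comp hlog)
      exact this
    refine Filter.tendsto_atTop_mono (fun k => ?_)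
      (Filter.tendsto_atTop_add_const_right _ (m * κ - M) hbar)
    have h1 : bar r (x k i) ≤ ∑ j, bar r (x k j) :=
      Finset.single_le_sum (f := fun j => bar r (x k j)) (fun j _ => bar_nonneg r _ (hx k j)) (Finset.mem_univ i)
    have h2 : w (x k) = ∑ j, bar r (x k j) + m * κ := by
      simp [hw, Finset.sum_add_distrib]
    have h3 := hM' (x k) (hQC (hx k))
    show _ ≤ w (x k) - H (x k)
    rw [h2]
    linarith
  obtain ⟨z, hzQ, hzmin⟩ := min_exists Q hQo ⟨0, h0Q⟩ _ hfc hblow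
    (fun c => hCb.subset fun y hy => hQC hy.1)
  have hle : H z ≤ w z := by
    refine hH.le_at_min hV w (Matrix.diagonal fun i => 2 * (r^2 + (z i)^2) / (r^2 - (z i)^2)^2)
      (Matrix.isHermitian_diagonal _)
      (fun v t => ∑ i, (2 * (z i + t * v i) / (r^2 - (z i + t * v i)^2)) * v i) z
      (hCV (hQC hzQ)) ?_ ?_ ?_ ?_
    · filter_upwards [hQo.mem_nhds hzQ] with y hy using hzmin y hy
    · intro v
      have hc : Filter.Tendsto (fun t : ℝ => z + t • v) (nhds 0) (nhds z) := by
        have : Continuous (fun t : ℝ => z + t • v) := by fun_prop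
        simpa using this.tendsto 0
      filter_upwards [hc.eventually (hQo.mem_nhds hzQ)] with t ht
      simp only [hw]
      refine HasDerivAt.fun_sum fun i _ => ?_
      have hl : HasDerivAt (fun t : ℝ => z i + t * v i) (v i) t := by
        simpa using ((hasDerivAt_id t).mul_const (v i)).const_add (z i)
      have hti : |z i + t * v i| < r := by simpa using ht i
      have := ((bar_deriv r _ hti).comp t hl).add_const κ
      simpa [Function.comp_def] using this
    · intro v
      have e : v.ofLp ⬝ᵥ ((Matrix.diagonal fun i => 2 * (r^2 + (z i)^2) / (r^2 - (z i)^2)^2) *ᵥ v.ofLp)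
        = ∑ i, (2 * (r^2 + (z i)^2) / (r^2 - (z i)^2)^2 * v i) * v i := by
        simp only [dotProduct, Matrix.mulVec_diagonal]
        exact Finset.sum_congr rfl fun i _ => by ring
      rw [e]
      refine HasDerivAt.fun_sum fun i _ => ?_
      have hl : HasDerivAt (fun t : ℝ => z i + t * v i) (v i) 0 := by
        simpa using ((hasDerivAt_id (0:ℝ)).mul_const (v i)).const_add (z i)
      have h2 : HasDerivAt (fun t => 2 * t / (r^2 - t^2))
          (2 * (r^2 + (z i)^2) / (r^2 - (z i)^2)^2) (z i + 0 * v i) := by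
        simpa using bar_deriv2 r (z i) (hzQ i)
      exact (h2.comp (0:ℝ) hl).mul_const (v i)
    · rw [Matrix.det_diagonal, hw, Finset.mul_sum, Real.exp_sum]
      refine Finset.prod_le_prod (fun i _ => by positivity) fun i _ => bar_exp r (z i) (hzQ i)
  have h0 := hzmin 0 h0Q
  have hw0 : w 0 = m * κ := by simp [hw, bar]
  simp only [hw0] at h0
  linarith

theorem main_compare {n : ℕ} {Ω : Set (Euc (n+1))} (hΩ : IsOpenProperConvexCone Ω)
    {F : Euc (n+1) → ℝ} (hF : IsCanonicalPotential n Ω F) {G : Euc (n+1) → ℝ} (hG : IsSub Ω G)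
    (l : Euc (n+1) →L[ℝ] ℝ) (s : ℝ) (hs : 0 < s) (hl : ∀ x ∈ Ω, s * ‖x‖ ≤ l x)
    (e : Euc (n+1)) (he : e ∈ Ω) (η : ℝ) (hη : 0 < η) (y : Euc (n+1)) (hy : y ∈ Ω) :
    G (y + e) ≤ F y + η * l y := by
  obtain ⟨C, hC⟩ := F_lower hΩ hF
  obtain ⟨hF1, hF2, hF3, hF4, hF5⟩ := hF
  have hΩo := hΩ.2.1
  -- uniform upper bound
  obtain ⟨K, hK⟩ : ∃ K : ℝ, ∀ y ∈ Ω, G (y + e) ≤ K := by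
    obtain ⟨ρ, hρ, hball⟩ := Metric.isOpen_iff.1 hΩo e he
    set r := ρ / (2 * (n + 1)) with hr
    have hr0 : 0 < r := by positivity
    refine ⟨((n + 1 : ℕ) : ℝ) * (Real.log (4 / r^2) / 2), fun y hy => ?_⟩
    have := cube_bound (hΩo.preimage (by fun_prop : Continuous fun z => z + (y + e)))
      (hG.translate (y + e)) r hr0 (fun x hx => ?_)
    · simpa using this
    · have h1 := euc_norm_le x r hx
      have h2 : ((n + 1 : ℕ) : ℝ) * r = ρ / 2 := by
        rw [hr]; push_cast; field_simp
      have h3 : x + e ∈ Ω := hball (by simp; linarith)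
      have h4 := cone_add hΩ hy h3
      show x + (y + e) ∈ Ω
      rwa [show x + (y + e) = y + (x + e) by abel]
  have hsub : IsSub Ω (fun z => G (z + e)) :=
    (hG.translate e).mono (fun z hz => cone_add hΩ hz he) hΩ.2.2.1
  have hF2' : ContDiffOn ℝ 2 F Ω := hF1.of_le two_le_top
  have hcont : ContinuousOn (fun z => (F z + η * l z) - G (z + e)) Ω :=
    (hF1.continuousOn.add (by fun_prop)).sub hsub.1.continuousOn
  have hl0 : ∀ x ∈ Ω, 0 ≤ l x := fun x hx => le_trans (by positivity) (hl x hx)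
  have hblow : BlowsUpOnBoundary Ω (fun z => (F z + η * l z) - G (z + e)) := by
    intro z hz x hx hxz
    refine Filter.tendsto_atTop_mono (fun k => ?_)
      (Filter.tendsto_atTop_add_const_right _ (-K) (hF5 z hz x hx hxz))
    have h1 := hK _ (hx k)
    have h2 := mul_nonneg hη.le (hl0 _ (hx k))
    linarith
  have hbd : ∀ c, Bornology.IsBounded {y | y ∈ Ω ∧ (F y + η * l y) - G (y + e) ≤ c} := by
    intro c
    rw [Metric.isBounded_iff_subset_closedBall (0 : Euc (n+1))]
    set δ := η * s / (2 * (n + 1)) with hδ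
    have hδ0 : 0 < δ := by positivity
    refine ⟨(c + C + K - (n+1) - (n+1) * Real.log δ) / (η * s / 2), fun y hy => ?_⟩
    obtain ⟨hyΩ, hyc⟩ := hy
    obtain ⟨hn, hlow⟩ := hC y hyΩ
    have h1 := hK y hyΩ
    have h2 := mul_le_mul_of_nonneg_left (hl y hyΩ) hη.le
    have h3 := Real.log_le_sub_one_of_pos (mul_pos hδ0 hn)
    rw [Real.log_mul hδ0.ne' hn.ne'] at h3
    have h4 := mul_le_mul_of_nonneg_left h3 (show (0:ℝ) ≤ n + 1 by positivity)
    have h5 : ((n:ℝ) + 1) * (δ * ‖y‖) = η * s / 2 * ‖y‖ := by rw [hδ]; field_simp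
    rw [mem_closedBall_zero_iff, le_div_iff₀ (by positivity)]
    nlinarith
  obtain ⟨z, hz, hmin⟩ := min_exists Ω hΩo hΩ.1 _ hcont hblow hbd
  have hFz : ContDiffAt ℝ 2 F z := hF2'.contDiffAt (hΩo.mem_nhds hz)
  have hle : G (z + e) ≤ F z + η * l z := by
    refine hsub.le_at_min hΩo (fun z => F z + η * l z) (hessMatrix F z) (hF2 z hz).1
      (fun v t => fderiv ℝ F (z + t • v) v + η * l v) z hz ?_ ?_ ?_ ?_
    · filter_upwards [hΩo.mem_nhds hz] with y hy using hmin y hy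
    · intro v
      filter_upwards [line_deriv_one F z v hFz] with t ht
      refine ht.add ?_
      have : HasDerivAt (fun t : ℝ => η * (l z + t * l v)) (η * l v) t := by
        simpa using (((hasDerivAt_id t).mul_const (l v)).const_add (l z)).const_mul η
      simpa using this
    · intro v
      rw [hess_quad]
      exact (line_deriv_two F z v hFz).add_const _
    · rw [hF3 z hz]
      have := mul_nonneg hη.le (hl0 z hz)
      exact Real.exp_le_exp.2 (by linarith)
  have := hmin y hy
  linarith

theorem sub_le {n : ℕ} {Ω : Set (Euc (n+1))} (hΩ : IsOpenProperConvexCone Ω)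
    {F : Euc (n+1) → ℝ} (hF : IsCanonicalPotential n Ω F) {G : Euc (n+1) → ℝ} (hG : IsSub Ω G)
    (x : Euc (n+1)) (hx : x ∈ Ω) : G x ≤ F x := by
  obtain ⟨l, s, hs, hl⟩ := exists_pos_functional hΩ
  have key : ∀ t : ℝ, 0 < t → G x ≤ F x + (n + 1) * t := by
    intro t ht
    have h1 : Real.exp (-t) < 1 := by rw [Real.exp_lt_one_iff]; linarith
    have hy : Real.exp (-t) • x ∈ Ω := hΩ.2.2.2.1 x hx _
    have he : (1 - Real.exp (-t)) • x ∈ Ω := cone_smul hΩ hx (by linarith)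
    have hsum : Real.exp (-t) • x + (1 - Real.exp (-t)) • x = x := by
      rw [← add_smul]; simp
    have hFy := hF.2.2.2.1 x hx (-t)
    have h2 : ∀ η : ℝ, 0 < η → G x ≤ F (Real.exp (-t) • x) + η * l (Real.exp (-t) • x) := by
      intro η hη
      have := main_compare hΩ hF hG l s hs hl _ he η hη _ hy
      rwa [hsum] at this
    set L := l (Real.exp (-t) • x) with hL
    have hL0 : 0 ≤ L := le_trans (by positivity) (hl _ hy)
    have h3 : G x ≤ F (Real.exp (-t) • x) := by
      refine le_of_forall_pos_le_add fun ε hε => ?_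
      have h4 := h2 (ε / (L + 1)) (by positivity)
      have h5 : ε / (L + 1) * L ≤ ε := by
        rw [div_mul_eq_mul_div, div_le_iff₀ (by positivity)]
        nlinarith
      linarith
    rw [hFy] at h3
    linarith
  refine le_of_forall_pos_le_add fun ε hε => ?_
  have := key (ε / (n + 1)) (by positivity)
  rwa [mul_div_cancel₀ _ (by positivity)] at this

/-- The canonical potential is the pointwise supremum, attained at `G = F`, of all `C²`
convex functions `G` on `Ω` satisfying `det D²G ≥ e^{2G}`. -/
theorem canonical_potential_isGreatest
    (n : ℕ) (Ω : Set (Euc (n + 1))) (hΩ : IsOpenProperConvexCone Ω)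
    (F : Euc (n + 1) → ℝ) (hF : IsCanonicalPotential n Ω F) :
    (ContDiffOn ℝ 2 F Ω ∧ ConvexOn ℝ Ω F ∧
      ∀ z ∈ Ω, Real.exp (2 * F z) ≤ (hessMatrix F z).det) ∧
    ∀ x ∈ Ω,
      IsGreatest {y : ℝ | ∃ G : Euc (n + 1) → ℝ,
        ContDiffOn ℝ 2 G Ω ∧ ConvexOn ℝ Ω G ∧
        (∀ z ∈ Ω, Real.exp (2 * G z) ≤ (hessMatrix G z).det) ∧ y = G x} (F x) := by
  obtain ⟨hF1, hF2, hF3, hF4, hF5⟩ := id hF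
  have hF2' : ContDiffOn ℝ 2 F Ω := hF1.of_le two_le_top
  have hconv := convexOn_of_hess F Ω hΩ.2.1 hΩ.2.2.1 hF2' hF2
  have hsub : ∀ z ∈ Ω, Real.exp (2 * F z) ≤ (hessMatrix F z).det := fun z hz => (hF3 z hz).ge
  refine ⟨⟨hF2', hconv, hsub⟩, fun x hx => ⟨⟨F, hF2', hconv, hsub, rfl⟩, ?_⟩⟩
  rintro y ⟨G, h1, h2, h3, rfl⟩
  exact sub_le hΩ hF ⟨h1, h2, h3⟩ x hx
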